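/- arXiv:2209.11105 — 2 statements merged into one kernel-verified Lean document; each statement's English description precedes it below -/
import Mathlib

section
/- Let c, d be real numbers with c < 0, d < 0 and c ≠ d, set γ = −(c + d), and let h(t) = (exp(c·t) − exp(d·t))/(c − d), with derivative g = h'. Then for every real τ ≥ 0, ∫₀^∞ g(t)·g(t + τ) dt = (1/(2γ))·g(τ). -/
open MeasureTheory

/-- The derivative of the overdamped impulse-response kernel. -/
lemma deriv_exp_sub_exp_div (c d : ℝ) :
    deriv (fun t : ℝ => (Real.exp (c * t) - Real.exp (d * t)) / (c - d)) =
      fun t => (c * Real.exp (c * t) - d * Real.exp (d * t)) / (c - d) := by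
  have hexp (a t : ℝ) : HasDerivAt (fun t : ℝ => Real.exp (a * t)) (a * Real.exp (a * t)) t := by
    simpa [mul_comm] using ((hasDerivAt_id t).const_mul a).exp
  funext t
  exact (((hexp c t).sub (hexp d t)).div_const (c - d)).deriv

/-- A combination of three decaying exponentials integrates termwise over the half-line. -/
lemma integral_Ioi_exp_combination {p q r : ℝ} (hp : p < 0) (hq : q < 0) (hr : r < 0)
    (A B C : ℝ) :
    ∫ t in Set.Ioi (0 : ℝ), (A * Real.exp (p * t) + B * Real.exp (q * t) + C * Real.exp (r * t)) =
      -(A / p + B / q + C / r) := by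
  have hA := (integrableOn_exp_mul_Ioi hp 0).const_mul A
  have hB := (integrableOn_exp_mul_Ioi hq 0).const_mul B
  have hC := (integrableOn_exp_mul_Ioi hr 0).const_mul C
  have hAB : IntegrableOn (fun t : ℝ => A * Real.exp (p * t) + B * Real.exp (q * t))
      (Set.Ioi 0) := hA.add hB
  rw [integral_add hAB hC, integral_add hA hB, integral_const_mul, integral_const_mul,
    integral_const_mul, integral_exp_mul_Ioi hp, integral_exp_mul_Ioi hq, integral_exp_mul_Ioi hr]
  simp only [mul_zero, Real.exp_zero]
  ring

/-- Autocorrelation of the overdamped frequency kernel `g = h'` is proportional to the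
kernel itself: `∫₀^∞ g(t) g(t+τ) dt = (1/(2γ)) g(τ)` for `τ ≥ 0`. -/
theorem overdamped_freq_autocorrelation
    (c d : ℝ) (hc : c < 0) (hd : d < 0) (hcd : c ≠ d)
    (γ : ℝ) (hγ : γ = -(c + d))
    (h : ℝ → ℝ)
    (hh : h = fun t => (Real.exp (c * t) - Real.exp (d * t)) / (c - d))
    (g : ℝ → ℝ) (hg : g = deriv h) :
    ∀ τ : ℝ, 0 ≤ τ →
      ∫ t in Set.Ioi (0 : ℝ), g t * g (t + τ) = (1 / (2 * γ)) * g τ := by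
  intro τ _
  subst hγ hg hh
  rw [deriv_exp_sub_exp_div]
  have hsub : c - d ≠ 0 := sub_ne_zero.mpr hcd
  have hadd : c + d ≠ 0 := (add_neg hc hd).ne
  have hc0 := hc.ne
  have hd0 := hd.ne
  set E := Real.exp (c * τ) with hE
  set D := Real.exp (d * τ) with hD
  have expand (t : ℝ) :
      (c * Real.exp (c * t) - d * Real.exp (d * t)) / (c - d) *
          ((c * Real.exp (c * (t + τ)) - d * Real.exp (d * (t + τ))) / (c - d)) =
        c ^ 2 * E / (c - d) ^ 2 * Real.exp ((2 * c) * t) +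
          -(c * d * (E + D)) / (c - d) ^ 2 * Real.exp ((c + d) * t) +
          d ^ 2 * D / (c - d) ^ 2 * Real.exp ((2 * d) * t) := by
    rw [mul_add, mul_add, add_mul, two_mul, two_mul, add_mul, add_mul]
    simp only [Real.exp_add, ← hE, ← hD]
    field_simp
    ring
  simp only [expand]
  rw [integral_Ioi_exp_combination (by linarith) (by linarith) (by linarith)]
  field_simp
  ring
end

section
/- Let γ > 0 be real, let I be a finite index set, and for each i ∈ I let λᵢ be a real number with 0 < λᵢ < γ²/4; set cᵢ = −γ/2 + √(γ²/4 − λᵢ), dᵢ = −γ/2 − √(γ²/4 − λᵢ), and hᵢ(t) = (exp(cᵢ·t) − exp(dᵢ·t))/(cᵢ − dᵢ). Let wᵢ be real weights, and define H(τ) = Σᵢ wᵢ·hᵢ(τ) and C(τ) = Σᵢ wᵢ·∫₀^∞ hᵢ(t)·hᵢ(t + τ) dt for τ ≥ 0. Then C is differentiable on [0, ∞) and C'(τ) = −(1/(2γ))·H(τ) for every τ ≥ 0. -/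
open MeasureTheory

/-- The autocorrelation of the impulse response with two distinct negative real poles `c`, `d`. -/
theorem integral_expDiff_mul_shift {c d : ℝ} (hc : c < 0) (hd : d < 0) (hcd : c ≠ d) (τ : ℝ) :
    ∫ t in Set.Ioi (0 : ℝ), (Real.exp (c * t) - Real.exp (d * t)) / (c - d) *
        ((Real.exp (c * (t + τ)) - Real.exp (d * (t + τ))) / (c - d)) =
      (Real.exp (c * τ) / c - Real.exp (d * τ) / d) / (2 * (c + d) * (c - d)) := by
  have hsub : c - d ≠ 0 := sub_ne_zero.mpr hcd
  have hsum : c + d < 0 := add_neg hc hd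
  have hcc : c + c < 0 := add_neg hc hc
  have hdd : d + d < 0 := add_neg hd hd
  have expand : ∀ t : ℝ, (Real.exp (c * t) - Real.exp (d * t)) / (c - d) *
        ((Real.exp (c * (t + τ)) - Real.exp (d * (t + τ))) / (c - d)) =
      Real.exp (c * τ) / (c - d) ^ 2 * Real.exp ((c + c) * t)
        - (Real.exp (c * τ) + Real.exp (d * τ)) / (c - d) ^ 2 * Real.exp ((c + d) * t)
        + Real.exp (d * τ) / (c - d) ^ 2 * Real.exp ((d + d) * t) := by
    intro t
    simp only [mul_add, add_mul, Real.exp_add]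
    field_simp
    ring
  have icc := (integrableOn_exp_mul_Ioi hcc 0).const_mul (Real.exp (c * τ) / (c - d) ^ 2)
  have icd := (integrableOn_exp_mul_Ioi hsum 0).const_mul
    ((Real.exp (c * τ) + Real.exp (d * τ)) / (c - d) ^ 2)
  have idd := (integrableOn_exp_mul_Ioi hdd 0).const_mul (Real.exp (d * τ) / (c - d) ^ 2)
  simp_rw [expand]
  rw [integral_add (by exact icc.sub icd) idd, integral_sub icc icd]
  simp only [integral_const_mul, integral_exp_mul_Ioi hcc, integral_exp_mul_Ioi hsum,
    integral_exp_mul_Ioi hdd, mul_zero, Real.exp_zero]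
  rw [← two_mul c, ← two_mul d]
  have hc0 := hc.ne
  have hd0 := hd.ne
  have hsum0 := hsum.ne
  field_simp
  ring

/-- Weighted-sum identity: for finitely many overdamped modes with common damping `γ`,
the weighted sum of single-mode autocorrelations `C(τ) = Σᵢ wᵢ ∫₀^∞ hᵢ(t)hᵢ(t+τ)dt`
satisfies `C'(τ) = -(1/(2γ)) H(τ)` where `H(τ) = Σᵢ wᵢ hᵢ(τ)`. -/
theorem weighted_modal_autocorrelation_deriv
    (γ : ℝ) (hγ : 0 < γ)
    (I : Type*) [Fintype I]
    (lam : I → ℝ) (hlam : ∀ i, 0 < lam i ∧ lam i < γ ^ 2 / 4)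
    (c d : I → ℝ)
    (hc : ∀ i, c i = -γ / 2 + Real.sqrt (γ ^ 2 / 4 - lam i))
    (hd : ∀ i, d i = -γ / 2 - Real.sqrt (γ ^ 2 / 4 - lam i))
    (h : I → ℝ → ℝ)
    (hh : ∀ i, h i = fun t => (Real.exp (c i * t) - Real.exp (d i * t)) / (c i - d i))
    (w : I → ℝ)
    (H C : ℝ → ℝ)
    (hH : ∀ τ : ℝ, H τ = ∑ i, w i * h i τ)
    (hC : ∀ τ : ℝ, 0 ≤ τ →
      C τ = ∑ i, w i * ∫ t in Set.Ioi (0 : ℝ), h i t * h i (t + τ)) :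
    ∀ τ : ℝ, 0 ≤ τ →
      HasDerivWithinAt C (-(1 / (2 * γ)) * H τ) (Set.Ici 0) τ := by
  intro τ hτ
  have hsum : ∀ i, c i + d i = -γ := fun i => by rw [hc, hd]; ring
  have hlt : ∀ i, d i < c i := fun i => by
    have := Real.sqrt_pos.mpr (sub_pos.mpr (hlam i).2)
    rw [hc, hd]
    linarith
  have hcneg : ∀ i, c i < 0 := fun i => by
    have : Real.sqrt (γ ^ 2 / 4 - lam i) < γ / 2 := by
      rw [Real.sqrt_lt' (by positivity)]
      linarith [(hlam i).1]
    rw [hc]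
    linarith
  have hdneg : ∀ i, d i < 0 := fun i => (hlt i).trans (hcneg i)
  have closed_form : ∀ σ ∈ Set.Ici (0 : ℝ), C σ = ∑ i, w i *
      ((Real.exp (c i * σ) / c i - Real.exp (d i * σ) / d i) /
        (2 * (c i + d i) * (c i - d i))) := by
    intro σ hσ
    rw [hC σ hσ]
    refine Finset.sum_congr rfl fun i _ => ?_
    simp only [hh]
    rw [integral_expDiff_mul_shift (hcneg i) (hdneg i) (hlt i).ne']
  refine HasDerivWithinAt.congr_of_mem ?_ closed_form hτ
  rw [hH, Finset.mul_sum]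
  refine (HasDerivAt.fun_sum fun i _ => ?_).hasDerivWithinAt
  have hexp : ∀ a : ℝ, HasDerivAt (fun σ => Real.exp (a * σ)) (Real.exp (a * τ) * a) τ :=
    fun a => by simpa using ((hasDerivAt_id τ).const_mul a).exp
  refine (((((hexp (c i)).div_const (c i)).sub ((hexp (d i)).div_const (d i))).div_const
    (2 * (c i + d i) * (c i - d i))).const_mul (w i)).congr_deriv ?_
  have hc0 := (hcneg i).ne
  have hd0 := (hdneg i).ne
  have hsub : c i - d i ≠ 0 := (sub_pos.mpr (hlt i)).ne'
  rw [hh, hsum, mul_div_cancel_right₀ _ hc0, mul_div_cancel_right₀ _ hd0]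
  field_simp
end
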